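/- There is no Lucas number that is a palindromic concatenation of two distinct repdigits; that is, there are no positive integers n, ℓ, m and digits d1 ∈ {1,…,9}, d2 ∈ {0,…,9} with d1 ≠ d2 such that L_n equals the number whose decimal expansion consists of ℓ copies of d1, followed by m copies of d2, followed by ℓ copies of d1. -/

import Mathlib

/-- The Lucas sequence: L 0 = 2, L 1 = 1, L (n+2) = L (n+1) + L n. -/
def lucas : ℕ → ℕ
  | 0 => 2
  | 1 => 1
  | n + 2 => lucas (n + 1) + lucas n

section PalindromicConcat

open Finset

theorem factorial_dvd_two_pow_mul_prod (c s i : ℕ) :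
    i.factorial ∣ 2 ^ i * ∏ k ∈ range i, (8 * (s + k) + c) := by
  obtain ⟨v, w, hw, hvw⟩ := Nat.exists_eq_two_pow_mul_odd i.factorial_ne_zero
  have hv : v ≤ i := by
    rcases Nat.eq_zero_or_pos i with rfl | hi
    · by_contra hne
      have : 2 ∣ Nat.factorial 0 := hvw ▸ Dvd.dvd.mul_right (dvd_pow_self 2 (by omega)) w
      simp at this
    · have h1 := Nat.emultiplicity_two_factorial_lt hi.ne'
      have h2 : 2 ^ v ∣ i.factorial := hvw ▸ Dvd.intro _ rfl
      have h3 := le_emultiplicity_of_pow_dvd h2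
      exact_mod_cast (h3.trans_lt h1).le
  have hc8 : Nat.Coprime 8 w := by
    have : Nat.Coprime (2 ^ 3) w := Nat.Coprime.pow_left 3 (Nat.coprime_two_left.mpr hw)
    simpa using this
  obtain ⟨t, ht⟩ : ∃ t : ℕ, c ≡ 8 * t [MOD w] := by
    have : NeZero w := ⟨hw.pos.ne'⟩
    refine ⟨((8 : ZMod w)⁻¹ * c).val, ?_⟩
    rw [← ZMod.natCast_eq_natCast_iff]
    push_cast
    rw [ZMod.natCast_zmod_val, ← mul_assoc]
    have := ZMod.coe_mul_inv_eq_one 8 hc8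
    push_cast at this
    rw [this, one_mul]
  have hprod : w ∣ ∏ k ∈ range i, (8 * (s + k) + c) := by
    have h1 : ∏ k ∈ range i, (8 * (s + k) + c) ≡ ∏ k ∈ range i, (8 * (s + t + k)) [MOD w] := by
      refine Nat.ModEq.prod fun k _ => ?_
      rw [show 8 * (s + t + k) = 8 * (s + k) + 8 * t by ring]
      exact ht.add_left _
    refine (h1.dvd_iff dvd_rfl).mpr ?_
    rw [prod_mul_distrib, ← Nat.ascFactorial_eq_prod_range]
    refine Dvd.dvd.mul_left (Dvd.dvd.trans ?_ (Nat.factorial_dvd_ascFactorial _ _)) _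
    exact hvw ▸ Dvd.intro_left _ rfl
  rw [hvw]
  exact mul_dvd_mul (pow_dvd_pow 2 hv) hprod

/-- The (positive, integral) coefficients of the diagonal Padé approximants to `x ^ (1 / 8)`. -/
def padeCoeff (j i : ℕ) : ℕ :=
  2 ^ i * (∏ k ∈ range i, (8 * (j - i + k) + 9)) / i.factorial *
    (2 ^ (j - i) * (∏ k ∈ range (j - i), (8 * (i + k) + 7)) / (j - i).factorial)

theorem padeCoeff_pos (j i : ℕ) : 0 < padeCoeff j i := by
  have h (c s i : ℕ) (hc : 0 < c) :
      0 < 2 ^ i * (∏ k ∈ range i, (8 * (s + k) + c)) / i.factorial :=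
    Nat.div_pos (Nat.le_of_dvd (Nat.mul_pos (by positivity) (prod_pos fun k _ => by omega))
      (factorial_dvd_two_pow_mul_prod c s i)) i.factorial_pos
  exact Nat.mul_pos (h _ _ _ (by norm_num)) (h _ _ _ (by norm_num))

theorem two_pow_mul_prod_div_le (c s i : ℕ) (hc : c ≤ 8) :
    2 ^ i * (∏ k ∈ range i, (8 * (s + k) + c)) / i.factorial ≤ 16 ^ i * (s + i).choose i := by
  refine Nat.div_le_of_le_mul ?_
  have h : ∏ k ∈ range i, (8 * (s + k) + c) ≤ ∏ k ∈ range i, (8 * (s + 1 + k)) :=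
    prod_le_prod' fun k _ => by omega
  rw [prod_mul_distrib, ← Nat.ascFactorial_eq_prod_range, Nat.ascFactorial_eq_factorial_mul_choose,
    prod_const, card_range] at h
  calc _ ≤ 2 ^ i * (8 ^ i * (i.factorial * (s + i).choose i)) := Nat.mul_le_mul_left _ h
    _ = _ := by rw [show 16 = 2 * 8 from rfl, mul_pow]; ring

theorem sum_padeCoeff_le (j : ℕ) : ∑ i ∈ range (j + 1), padeCoeff j i ≤ 2 * 64 ^ j := by
  have h (i : ℕ) (hi : i ∈ range (j + 1)) :
      padeCoeff j i ≤ 16 ^ j * 2 ^ (j + 1) * j.choose i := by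
    have hij : i ≤ j := by simpa [Nat.lt_succ_iff] using hi
    have h1 := two_pow_mul_prod_div_le 1 (j - i + 1) i (by norm_num)
    have h2 := two_pow_mul_prod_div_le 7 i (j - i) (by norm_num)
    simp only [show ∀ k, 8 * (j - i + 1 + k) + 1 = 8 * (j - i + k) + 9 by intro k; ring] at h1
    rw [show j - i + 1 + i = j + 1 by omega] at h1
    rw [show i + (j - i) = j by omega, Nat.choose_symm hij] at h2
    calc _ ≤ _ := Nat.mul_le_mul h1 h2
      _ ≤ 16 ^ i * 2 ^ (j + 1) * (16 ^ (j - i) * j.choose i) := by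
        gcongr
        exact Nat.choose_le_two_pow _ _
      _ = 16 ^ (i + (j - i)) * 2 ^ (j + 1) * j.choose i := by rw [pow_add]; ring
      _ = _ := by rw [show i + (j - i) = j by omega]
  calc _ ≤ _ := sum_le_sum h
    _ = 2 * 64 ^ j := by
      rw [← mul_sum, Nat.sum_range_choose, show 64 = 16 * 2 * 2 from rfl, mul_pow, mul_pow]; ring

theorem prod_erase_eight_mul_sub (i k : ℕ) :
    ∏ x ∈ (range (i + k + 1)).erase i, ((8 * i : ℚ) - 8 * x) =
      8 ^ (i + k) * (-1) ^ k * i.factorial * k.factorial := by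
  have h1 : ∏ x ∈ (range (i + k + 1)).erase i, ((8 * i : ℚ) - 8 * x) =
      (∏ x ∈ range i, ((8 * i : ℚ) - 8 * x)) * ∏ x ∈ range k, (-8 * ((x : ℚ) + 1)) := by
    have h2 : (range (i + k + 1)).erase i = range i ∪ (range k).image (fun x => i + 1 + x) := by
      ext x
      simp only [mem_erase, mem_range, mem_union, mem_image]
      constructor
      · rintro ⟨hx, hx'⟩
        rcases lt_or_gt_of_ne hx with h | h
        · exact .inl h
        · exact .inr ⟨x - i - 1, by omega, by omega⟩
      · rintro (h | ⟨y, hy, rfl⟩) <;> omega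
    rw [h2, prod_union, prod_image]
    · congr 1
      refine prod_congr rfl fun x _ => ?_
      push_cast; ring
    · intro x _ y _ h
      simpa using h
    · rw [disjoint_left]
      intro x hx hx'
      simp only [mem_range, mem_image] at hx hx'
      omega
  rw [h1, ← prod_range_reflect, prod_mul_distrib, prod_const, card_range]
  have h3 : ∏ x ∈ range i, ((8 * i : ℚ) - 8 * ((i - 1 - x : ℕ) : ℚ)) =
      ∏ x ∈ range i, 8 * (((x + 1 : ℕ)) : ℚ) := by
    refine prod_congr rfl fun x hx => ?_
    have : x < i := mem_range.mp hx
    rw [Nat.sub_sub, Nat.cast_sub (by omega)]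
    push_cast; ring
  rw [h3, prod_mul_distrib, prod_const, card_range, ← Nat.cast_prod,
    prod_range_add_one_eq_factorial]
  have h4 : ∏ x ∈ range k, ((x : ℚ) + 1) = k.factorial := by
    rw [← prod_range_add_one_eq_factorial]; push_cast; rfl
  rw [h4, show (-8 : ℚ) = 8 * (-1) by norm_num, mul_pow, pow_add]
  ring

theorem prod_eight_mul_sub_add_one (i k : ℕ) :
    ∏ x ∈ range (i + k + 1), ((8 * i : ℚ) - (8 * x + 1)) =
      (-1) ^ (k + 1) * (∏ x ∈ range i, (8 * x + 7 : ℚ)) * ∏ x ∈ range k, (8 * x + 9 : ℚ) := by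
  rw [show i + k + 1 = i + (k + 1) by ring, prod_range_add, ← prod_range_reflect, prod_range_succ']
  have h1 : ∏ x ∈ range i, ((8 * i : ℚ) - (8 * ((i - 1 - x : ℕ) : ℚ) + 1)) =
      ∏ x ∈ range i, (8 * x + 7 : ℚ) := by
    refine prod_congr rfl fun x hx => ?_
    have : x < i := mem_range.mp hx
    rw [Nat.sub_sub, Nat.cast_sub (by omega)]
    push_cast; ring
  have h2 : ∏ x ∈ range k, ((8 * i : ℚ) - (8 * ((i + (x + 1) : ℕ) : ℚ) + 1)) =
      ∏ x ∈ range k, (-1) * (8 * x + 9 : ℚ) := by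
    refine prod_congr rfl fun x hx => ?_
    push_cast; ring
  rw [h1, h2, prod_mul_distrib, prod_const, card_range]
  push_cast
  ring

theorem prod_eight_mul_add_one_sub (i k : ℕ) :
    ∏ x ∈ range (i + k + 1), ((8 * i + 1 : ℚ) - 8 * x) =
      (-1) ^ k * (∏ x ∈ range i, (8 * x + 9 : ℚ)) * ∏ x ∈ range k, (8 * x + 7 : ℚ) := by
  have h := prod_eight_mul_sub_add_one k i
  rw [show k + i + 1 = i + k + 1 by ring] at h
  have h1 : ∏ x ∈ range (i + k + 1), ((8 * i + 1 : ℚ) - 8 * x) =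
      ∏ x ∈ range (i + k + 1), (-1) * ((8 * k : ℚ) - (8 * x + 1)) := by
    rw [← prod_range_reflect]
    refine prod_congr rfl fun x hx => ?_
    have : x < i + k + 1 := mem_range.mp hx
    rw [show i + k + 1 - 1 - x = i + k - x by omega, Nat.cast_sub (by omega)]
    push_cast; ring
  rw [h1, prod_mul_distrib, h, prod_const, card_range]
  have : ((-1 : ℚ)) ^ (i + k + 1) * (-1) ^ (i + 1) = (-1) ^ k := by
    rw [← pow_add, show i + k + 1 + (i + 1) = k + 2 * (i + 1) by ring, pow_add, pow_mul]
    norm_num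
  rw [← this]; ring

theorem cast_padeCoeff (i k : ℕ) :
    (padeCoeff (i + k) i : ℚ) =
      2 ^ (i + k) * (∏ x ∈ range (i + k), (8 * x + 9 : ℚ)) *
        (∏ x ∈ range (i + k), (8 * x + 7 : ℚ)) /
        (i.factorial * k.factorial * (∏ x ∈ range i, (8 * x + 7 : ℚ)) *
          ∏ x ∈ range k, (8 * x + 9 : ℚ)) := by
  have hpos (c : ℚ) (hc : 0 < c) (n : ℕ) : ∏ x ∈ range n, (8 * x + c : ℚ) ≠ 0 :=
    (prod_pos fun x _ => by positivity).ne'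
  rw [padeCoeff, Nat.add_sub_cancel_left, Nat.cast_mul,
    Nat.cast_div (factorial_dvd_two_pow_mul_prod _ _ _) (by positivity),
    Nat.cast_div (factorial_dvd_two_pow_mul_prod _ _ _) (by positivity)]
  rw [prod_range_add (fun x : ℕ => (8 * x + 7 : ℚ)) i k]
  rw [show range (i + k) = range (k + i) by rw [add_comm],
    prod_range_add (fun x : ℕ => (8 * x + 9 : ℚ)) k i]
  push_cast
  have := hpos 7 (by norm_num) i
  have := hpos 9 (by norm_num) k
  field_simp
  ring

open Polynomial in
theorem sum_choose_padeCoeff (j r : ℕ) (hr : r < 2 * j + 1) :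
    ∑ i ∈ range (j + 1), ((padeCoeff j i : ℚ) * (8 * i).choose r) =
      ∑ i ∈ range (j + 1), ((padeCoeff j (j - i) : ℚ) * (8 * i + 1).choose r) := by
  set v : ℕ ⊕ ℕ → ℚ := Sum.elim (fun i => 8 * i) (fun i => 8 * i + 1) with hv
  set s : Finset (ℕ ⊕ ℕ) := (range (j + 1)).disjSum (range (j + 1)) with hs
  have hcard : s.card = 2 * j + 2 := by rw [hs, card_disjSum, card_range]; ring
  have hinj : Set.InjOn v s := by
    rintro (x | x) - (y | y) - h <;> simp only [hv, Sum.elim_inl, Sum.elim_inr] at h <;>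
      norm_cast at h
    · congr 1; omega
    · omega
    · omega
    · congr 1; omega
  have hdeg : (descPochhammer ℚ r).natDegree = r := descPochhammer_natDegree _ _
  have hP := Lagrange.coeff_eq_sum hinj (P := descPochhammer ℚ r) (by
    refine (degree_le_natDegree).trans_lt ?_
    rw [hdeg, hcard]; exact_mod_cast (by omega))
  rw [coeff_eq_zero_of_natDegree_lt (by rw [hdeg, hcard]; omega), hs, sum_disjSum] at hP
  have e1 (i : ℕ) : ((range (j + 1)).disjSum (range (j + 1))).erase (Sum.inl i) =
      ((range (j + 1)).erase i).disjSum (range (j + 1)) := by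
    ext (x | x) <;> simp [inl_mem_disjSum, inr_mem_disjSum]
  have e2 (i : ℕ) : ((range (j + 1)).disjSum (range (j + 1))).erase (Sum.inr i) =
      (range (j + 1)).disjSum ((range (j + 1)).erase i) := by
    ext (x | x) <;> simp [inl_mem_disjSum, inr_mem_disjSum]
  have hpos (c : ℚ) (hc : 0 < c) (n : ℕ) : ∏ x ∈ range n, (8 * x + c : ℚ) ≠ 0 :=
    (prod_pos fun x _ => by positivity).ne'
  have h7 := hpos 7 (by norm_num)
  have h9 := hpos 9 (by norm_num)
  set K : ℚ := r.factorial / (8 ^ j * 2 ^ j * (∏ x ∈ range j, (8 * x + 9 : ℚ)) *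
    (∏ x ∈ range j, (8 * x + 7 : ℚ))) with hK
  have hK0 : K ≠ 0 := by
    have := h7 j
    have := h9 j
    positivity
  have hneg (k : ℕ) : ((-1 : ℚ)) ^ k ≠ 0 := by positivity
  have hsq (k : ℕ) : ((-1 : ℚ)) ^ k * (-1) ^ k = 1 := by rw [← mul_pow]; norm_num
  have heval (n : ℕ) : (descPochhammer ℚ r).eval (n : ℚ) = r.factorial * n.choose r := by
    rw [descPochhammer_eval_eq_descFactorial, Nat.descFactorial_eq_factorial_mul_choose]
    push_cast; rfl
  have t1 (i : ℕ) (hi : i ∈ range (j + 1)) :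
      (descPochhammer ℚ r).eval (v (Sum.inl i)) /
        ∏ x ∈ ((range (j + 1)).disjSum (range (j + 1))).erase (Sum.inl i), (v (Sum.inl i) - v x) =
      -(K * ((padeCoeff j i : ℚ) * (8 * i).choose r)) := by
    obtain ⟨k, rfl⟩ : ∃ k, j = i + k := ⟨j - i, by have := mem_range.mp hi; omega⟩
    have h1 := heval (8 * i)
    rw [e1, prod_disjSum]
    simp only [hv, Sum.elim_inl, Sum.elim_inr]
    push_cast at h1
    rw [h1, prod_erase_eight_mul_sub, prod_eight_mul_sub_add_one, cast_padeCoeff, hK, pow_succ]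
    have := h7 i
    have := h9 k
    have := h7 (i + k)
    have := h9 (i + k)
    have := hneg k
    field_simp
    linear_combination ((8 * i).choose r : ℚ) * hsq k
  have t2 (i : ℕ) (hi : i ∈ range (j + 1)) :
      (descPochhammer ℚ r).eval (v (Sum.inr i)) /
        ∏ x ∈ ((range (j + 1)).disjSum (range (j + 1))).erase (Sum.inr i), (v (Sum.inr i) - v x) =
      K * ((padeCoeff j (j - i) : ℚ) * (8 * i + 1).choose r) := by
    obtain ⟨k, rfl⟩ : ∃ k, j = k + i := ⟨j - i, by have := mem_range.mp hi; omega⟩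
    have h1 := heval (8 * i + 1)
    rw [e2, prod_disjSum]
    simp only [hv, Sum.elim_inl, Sum.elim_inr, add_sub_add_right_eq_sub, Nat.add_sub_cancel]
    push_cast at h1
    rw [h1, cast_padeCoeff, hK, add_comm k i, prod_erase_eight_mul_sub, prod_eight_mul_add_one_sub]
    have := h7 k
    have := h9 i
    have := h7 (i + k)
    have := h9 (i + k)
    have := hneg k
    field_simp
    linear_combination (-((8 * i + 1).choose r : ℚ)) * hsq k
  rw [sum_congr rfl t1, sum_congr rfl t2, sum_neg_distrib, ← mul_sum, ← mul_sum] at hP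
  exact mul_left_cancel₀ hK0 (by linear_combination hP)

open Polynomial in
theorem one_sub_X_pow_dvd_pade (j : ℕ) :
    ((1 - X : ℤ[X]) ^ (2 * j + 1)) ∣ ∑ i ∈ range (j + 1), (padeCoeff j i : ℤ[X]) * X ^ (8 * i) -
      ∑ i ∈ range (j + 1), (padeCoeff j (j - i) : ℤ[X]) * X ^ (8 * i + 1) := by
  rw [← neg_sub X 1, neg_pow, (isUnit_neg_one.pow _).mul_left_dvd, ← C_1, X_sub_C_pow_dvd_iff,
    X_pow_dvd_iff]
  intro r hr
  have h := sum_choose_padeCoeff j r hr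
  have hcoeff (a e : ℕ) : (((a : ℤ[X]) * X ^ e).comp (X + C 1)).coeff r =
      (a : ℤ) * (e.choose r : ℤ) := by
    rw [mul_comp, natCast_comp, X_pow_comp, ← C_eq_natCast, coeff_C_mul, C_1, coeff_X_add_one_pow]
  simp only [sub_comp, Polynomial.sum_comp, coeff_sub, finsetSum_coeff, hcoeff]
  rw [sub_eq_zero]
  exact_mod_cast h

theorem one_sub_pow_dvd_pade {R : Type*} [CommRing R] (j : ℕ) (z : R) :
    (1 - z) ^ (2 * j + 1) ∣ ∑ i ∈ range (j + 1), (padeCoeff j i : R) * z ^ (8 * i) -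
      ∑ i ∈ range (j + 1), (padeCoeff j (j - i) : R) * z ^ (8 * i + 1) := by
  simpa using map_dvd (Polynomial.aeval z) (one_sub_X_pow_dvd_pade j)

theorem lucas_add_two (n : ℕ) : lucas (n + 2) = lucas (n + 1) + lucas n := rfl

theorem lucas_add_period_modEq (n : ℕ) : lucas (n + 300) ≡ lucas n [MOD 2100901000] := by
  induction n using Nat.twoStepInduction with
  | zero => decide +kernel
  | one => decide +kernel
  | more n h0 h1 =>
    rw [show n + 2 + 300 = n + 300 + 2 by ring, lucas_add_two (n + 300), lucas_add_two n,
      show n + 300 + 1 = n + 1 + 300 by ring]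
    exact Nat.ModEq.add h1 h0

theorem lucas_modEq_mod_period (n : ℕ) : lucas n ≡ lucas (n % 300) [MOD 2100901000] := by
  have h (k r : ℕ) : lucas (r + 300 * k) ≡ lucas r [MOD 2100901000] := by
    induction k with
    | zero => exact Nat.ModEq.refl _
    | succ k ih =>
      rw [mul_add_one, ← add_assoc]
      exact (lucas_add_period_modEq _).trans ih
  have := h (n / 300) (n % 300)
  rwa [Nat.mod_add_div] at this

theorem ten_pow_modEq_of_modEq {M k a b : ℕ} (h : 10 ^ k ≡ 1 [MOD M]) (hab : a ≡ b [MOD k]) :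
    10 ^ a ≡ 10 ^ b [MOD M] := by
  have h1 (x : ℕ) : 10 ^ x ≡ 10 ^ (x % k) [MOD M] := by
    calc 10 ^ x = 10 ^ (x % k) * (10 ^ k) ^ (x / k) := by rw [← pow_mul, ← pow_add, Nat.mod_add_div]
      _ ≡ 10 ^ (x % k) * 1 ^ (x / k) [MOD M] := (h.pow _).mul_left _
      _ = _ := by simp
  have h2 := (h1 b).symm
  rw [← (show a % k = b % k from hab)] at h2
  exact (h1 a).trans h2

theorem ten_pow_modEq_of_three_le {x : ℕ} (hx : 3 ≤ x) : 10 ^ x ≡ 10 ^ 3 [MOD 9000] := by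
  induction x, hx using Nat.le_induction with
  | base => rfl
  | succ x _ ih => exact (ih.mul_right 10).trans (by decide)

theorem ten_pow_modEq_min (x : ℕ) : 10 ^ x ≡ 10 ^ min x 3 [MOD 9000] := by
  rcases le_total x 3 with h | h
  · rw [min_eq_left h]
  · rw [min_eq_right h]; exact ten_pow_modEq_of_three_le h

/-- The congruence modulo `M` satisfied by `N` when it is a palindromic concatenation with digits
`d1`, `d2` and `10 ^ ℓ ≡ x`, `10 ^ (ℓ + m) ≡ y`, `10 ^ (2 * ℓ + m) ≡ z` modulo `M`. -/
def palCongr (M N d1 d2 x y z : ℕ) : Bool :=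
  (9 * N + d1 * y + d2 * x + d1) % M == (d1 * z + d2 * y + d1 * x) % M

theorem palCongr_of_eq {M N N' d1 d2 x y z x' y' z' : ℕ}
    (h : 9 * N + d1 * y + d2 * x + d1 = d1 * z + d2 * y + d1 * x)
    (hN : 9 * N ≡ 9 * N' [MOD M]) (hx : x ≡ x' [MOD M]) (hy : y ≡ y' [MOD M])
    (hz : z ≡ z' [MOD M]) : palCongr M N' d1 d2 x' y' z' = true := by
  have h1 := ((hN.add (hy.mul_left d1)).add (hx.mul_left d2)).add_right d1
  have h2 := ((hz.mul_left d1).add (hy.mul_left d2)).add (hx.mul_left d1)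
  rw [h] at h1
  exact beq_iff_eq.mpr (h1.symm.trans h2)

theorem palCongr_zero {M N d1 d2 x : ℕ} (h : palCongr M N d1 d2 x x x = true) :
    palCongr M N d1 0 x x x = true := by
  refine beq_iff_eq.mpr (Nat.ModEq.add_right_cancel' (n := M) (d2 * x) ?_)
  have h1 : _ ≡ _ [MOD M] := beq_iff_eq.mp h
  convert h1 using 1 <;> ring

/-- The congruence `palCongr`, in terms of the exponents. -/
def palCongrExp (M N d1 d2 l m : ℕ) : Bool :=
  palCongr M N d1 d2 (10 ^ l) (10 ^ (l + m)) (10 ^ (2 * l + m))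

/-- The conjunction of the congruences modulo `11`, `61` and `101`. -/
def palCongrPrimes (N d1 d2 l m : ℕ) : Bool :=
  palCongrExp 61 N d1 d2 l m && palCongrExp 101 N d1 d2 l m && palCongrExp 11 N d1 d2 l m

/-- Boolean implication, evaluated lazily. -/
def implies (a b : Bool) : Bool := !a || b

theorem implies_eq_true {a b : Bool} : implies a b = true ↔ (a = true → b = true) := by
  cases a <;> cases b <;> decide

/-- No palindromic concatenation with `3 ≤ ℓ` satisfies all the congruences, except in one class. -/
def sieveLarge : Bool :=
  (List.range 300).all fun n => (List.range 10).all fun d1 =>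
    implies (d1 != 0 && palCongr 9000 (lucas n) d1 0 1000 1000 1000) <|
      (List.range 10).all fun d2 => implies (d1 != d2) <|
        (List.range 15).all fun l => (List.range 15).all fun m =>
          implies (palCongrExp 31 (lucas n) d1 d2 l m) <|
            (List.range 4).all fun u => (List.range 4).all fun v =>
              implies (palCongrPrimes (lucas n) d1 d2 (l + 15 * u) (m + 15 * v)) <|
                n == 299 && d1 == 9 && d2 == 8 && l == 14 && u == 3 && m == 1 && v == 0

/-- No palindromic concatenation with `ℓ ≤ 2` satisfies all the congruences. -/
def sieveSmall : Bool :=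
  (List.range 300).all fun n => (List.range 10).all fun d1 =>
    implies (d1 != 0 && palCongr 90 (lucas n) d1 0 10 10 10) <|
      (List.range 10).all fun d2 => implies (d1 != d2) <|
        [1, 2].all fun l => [1, 2, 3].all fun c =>
          implies (palCongr 9000 (lucas n) d1 d2 (10 ^ l) (10 ^ min (l + c) 3)
            (10 ^ min (2 * l + c) 3)) <|
            (List.range 15).all fun m => implies (palCongrExp 31 (lucas n) d1 d2 l m) <|
              (List.range 4).all fun v => !palCongrPrimes (lucas n) d1 d2 l (m + 15 * v)

theorem sieveLarge_eq_true : sieveLarge = true := by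
  decide +kernel

theorem sieveSmall_eq_true : sieveSmall = true := by
  decide +kernel

theorem lucas_modEq_of_dvd {M : ℕ} (hM : M ∣ 9 * 2100901000) (n : ℕ) :
    9 * lucas n ≡ 9 * lucas (n % 300) [MOD M] :=
  ((lucas_modEq_mod_period n).mul_left' 9).of_dvd hM

theorem palCongrExp_of_eq {M k n d1 d2 ℓ m l' m' : ℕ}
    (h : 9 * lucas n + d1 * 10 ^ (ℓ + m) + d2 * 10 ^ ℓ + d1 =
      d1 * 10 ^ (2 * ℓ + m) + d2 * 10 ^ (ℓ + m) + d1 * 10 ^ ℓ)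
    (hM : M ∣ 9 * 2100901000) (hk : 10 ^ k ≡ 1 [MOD M]) (hl : ℓ ≡ l' [MOD k])
    (hm : m ≡ m' [MOD k]) : palCongrExp M (lucas (n % 300)) d1 d2 l' m' = true :=
  palCongr_of_eq h (lucas_modEq_of_dvd hM n) (ten_pow_modEq_of_modEq hk hl)
    (ten_pow_modEq_of_modEq hk (hl.add hm)) (ten_pow_modEq_of_modEq hk ((hl.mul_left 2).add hm))

theorem palCongrPrimes_of_eq {n d1 d2 ℓ m l' m' : ℕ}
    (h : 9 * lucas n + d1 * 10 ^ (ℓ + m) + d2 * 10 ^ ℓ + d1 =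
      d1 * 10 ^ (2 * ℓ + m) + d2 * 10 ^ (ℓ + m) + d1 * 10 ^ ℓ)
    (hl : ℓ ≡ l' [MOD 60]) (hm : m ≡ m' [MOD 60]) :
    palCongrPrimes (lucas (n % 300)) d1 d2 l' m' = true := by
  rw [palCongrPrimes, palCongrExp_of_eq h (by norm_num) (by decide +kernel) hl hm,
    palCongrExp_of_eq h (by norm_num) (by decide +kernel) hl hm,
    palCongrExp_of_eq h (by norm_num) (by decide +kernel) hl hm]
  rfl

theorem mod_sieve {n d1 d2 ℓ m : ℕ} (hℓ : 1 ≤ ℓ) (hm : 1 ≤ m) (hd1 : 1 ≤ d1) (hd1' : d1 ≤ 9)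
    (hd2 : d2 ≤ 9) (hd : d1 ≠ d2)
    (h : 9 * lucas n + d1 * 10 ^ (ℓ + m) + d2 * 10 ^ ℓ + d1 =
      d1 * 10 ^ (2 * ℓ + m) + d2 * 10 ^ (ℓ + m) + d1 * 10 ^ ℓ) :
    n % 300 = 299 ∧ d1 = 9 ∧ d2 = 8 ∧ ℓ % 60 = 59 := by
  have hn : n % 300 < 300 := Nat.mod_lt _ (by norm_num)
  have hsplit (x : ℕ) : x ≡ x % 15 + 15 * (x % 60 / 15) [MOD 60] := by
    rw [show x % 15 + 15 * (x % 60 / 15) = x % 60 by omega]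
    exact (Nat.mod_modEq _ _).symm
  have hlt (x : ℕ) : x % 15 < 15 ∧ x % 60 / 15 < 4 := by omega
  have h31 := palCongrExp_of_eq (M := 31) (k := 15) h (by norm_num) (by decide +kernel)
    (Nat.mod_modEq ℓ 15).symm (Nat.mod_modEq m 15).symm
  rcases Nat.lt_or_ge ℓ 3 with hℓ3 | hℓ3
  · exfalso
    have hs := sieveSmall_eq_true
    simp only [sieveSmall, List.all_eq_true, List.mem_range, implies_eq_true] at hs
    have h90 : palCongr 90 (lucas (n % 300)) d1 0 10 10 10 = true := by
      have h1 {x : ℕ} (hx : 1 ≤ x) : 10 ^ x ≡ 10 [MOD 90] := by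
        induction x, hx using Nat.le_induction with
        | base => rfl
        | succ x _ ih => exact (ih.mul_right 10).trans (by decide)
      exact palCongr_zero (palCongr_of_eq h (lucas_modEq_of_dvd (by norm_num) n) (h1 hℓ)
        (h1 (show 1 ≤ ℓ + m by omega)) (h1 (show 1 ≤ 2 * ℓ + m by omega)))
    have h9000 : palCongr 9000 (lucas (n % 300)) d1 d2 (10 ^ ℓ) (10 ^ min (ℓ + min m 3) 3)
        (10 ^ min (2 * ℓ + min m 3) 3) = true := by
      rw [show min (ℓ + min m 3) 3 = min (ℓ + m) 3 by omega,
        show min (2 * ℓ + min m 3) 3 = min (2 * ℓ + m) 3 by omega]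
      exact palCongr_of_eq h (lucas_modEq_of_dvd (by norm_num) n) rfl (ten_pow_modEq_min _)
        (ten_pow_modEq_min _)
    have h31' := palCongrExp_of_eq (M := 31) (k := 15) h (by norm_num) (by decide +kernel)
      (Nat.ModEq.refl ℓ) (Nat.mod_modEq m 15).symm
    have hp := palCongrPrimes_of_eq h (Nat.ModEq.refl ℓ) (hsplit m)
    have := hs _ hn d1 (by omega) (by simp [h90]; omega) d2 (by omega) (by simpa using hd)
      ℓ (by simp; omega) (min m 3) (by simp; omega) h9000 _ (hlt m).1 h31' _ (hlt m).2
    rw [hp] at this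
    simp at this
  · have hs := sieveLarge_eq_true
    simp only [sieveLarge, List.all_eq_true, List.mem_range, implies_eq_true] at hs
    have h9000 : palCongr 9000 (lucas (n % 300)) d1 0 1000 1000 1000 = true := by
      exact palCongr_zero (palCongr_of_eq h (lucas_modEq_of_dvd (by norm_num) n)
        (ten_pow_modEq_of_three_le hℓ3) (ten_pow_modEq_of_three_le (show 3 ≤ ℓ + m by omega))
        (ten_pow_modEq_of_three_le (show 3 ≤ 2 * ℓ + m by omega)))
    have := hs _ hn d1 (by omega) (by simp [h9000]; omega) d2 (by omega) (by simpa using hd)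
      _ (hlt ℓ).1 _ (hlt m).1 h31 _ (hlt ℓ).2 _ (hlt m).2
      (palCongrPrimes_of_eq h (hsplit ℓ) (hsplit m))
    simp only [Bool.and_eq_true, beq_iff_eq] at this
    omega

theorem lucas_add_fib (n : ℕ) : lucas n + Nat.fib n = 2 * Nat.fib (n + 1) := by
  induction n using Nat.twoStepInduction with
  | zero => rfl
  | one => rfl
  | more n h0 h1 =>
    rw [show n + 2 + 1 = n + 1 + 2 by ring, Nat.fib_add_two (n := n + 1), lucas_add_two,
      Nat.fib_add_two (n := n)]
    rw [show n + 1 + 1 = n + 2 by ring, Nat.fib_add_two (n := n)] at *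
    omega

theorem fib_two_mul_eq_fib_mul_lucas (n : ℕ) : Nat.fib (2 * n) = Nat.fib n * lucas n := by
  rw [Nat.fib_two_mul, ← lucas_add_fib, Nat.add_sub_cancel]

theorem fib_cassini (n : ℕ) :
    (Nat.fib (n + 1) : ℤ) ^ 2 - Nat.fib (n + 1) * Nat.fib n - (Nat.fib n : ℤ) ^ 2 = (-1) ^ n := by
  induction n with
  | zero => norm_num
  | succ n ih =>
    rw [Nat.fib_add_two (n := n), pow_succ (-1 : ℤ), ← ih]
    push_cast
    ring

theorem lucas_two_mul_add_one_add_one {c : ℕ} (hc : Odd c) :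
    lucas (2 * c + 1) + 1 = 5 * Nat.fib (c + 1) * Nat.fib c := by
  have h1 := lucas_add_fib (2 * c + 1)
  have h2 := fib_cassini c
  have h3 := lucas_add_fib (c + 1)
  rw [hc.neg_one_pow] at h2
  rw [show 2 * c + 1 + 1 = 2 * (c + 1) by ring, fib_two_mul_eq_fib_mul_lucas,
    Nat.fib_two_mul_add_one] at h1
  rw [Nat.fib_add_two (n := c)] at h3
  zify at h1 h3 ⊢
  linear_combination h1 + 2 * (Nat.fib (c + 1) : ℤ) * h3 + h2

theorem dvd_of_sixtyFour_dvd_fib {a : ℕ} (h : 64 ∣ Nat.fib a) : 48 ∣ a := by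
  have h1 : 64 ∣ Nat.fib (Nat.gcd a 48) := by
    rw [Nat.fib_gcd]
    exact Nat.dvd_gcd h (by norm_num)
  have h2 : ∀ d ∈ Nat.divisors 48, 64 ∣ Nat.fib d → d = 48 := by decide +kernel
  have h3 := h2 _ (Nat.mem_divisors.mpr ⟨Nat.gcd_dvd_right a 48, by norm_num⟩) h1
  exact h3 ▸ Nat.gcd_dvd_left a 48

theorem not_dvd_lucas_of_even {x : ℕ} (hx : Even x) : ¬ 4 ∣ lucas x ∧ ¬ 5 ∣ lucas x := by
  have h1 (M : ℕ) (hM : M ∣ 2100901000) : M ∣ lucas x ↔ M ∣ lucas (x % 300) :=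
    ((lucas_modEq_mod_period x).of_dvd hM).dvd_iff dvd_rfl
  rw [h1 4 (by norm_num), h1 5 (by norm_num)]
  have h2 : ∀ r < 300, r % 2 = 0 → ¬ 4 ∣ lucas r ∧ ¬ 5 ∣ lucas r := by decide +kernel
  exact h2 _ (Nat.mod_lt _ (by norm_num)) (by obtain ⟨y, rfl⟩ := hx; omega)

theorem ten_pow_dvd_two_mul {k A L : ℕ} (h : 10 ^ k ∣ A * L) (h4 : ¬ 4 ∣ L) (h5 : ¬ 5 ∣ L) :
    10 ^ k ∣ 2 * A := by
  have hcop (B : ℕ) (h2 : ¬ 2 ∣ B) (h5 : ¬ 5 ∣ B) : Nat.Coprime (10 ^ k) B := by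
    refine Nat.Coprime.pow_left k ?_
    rw [show 10 = 2 * 5 from rfl]
    exact Nat.Coprime.mul_left ((Nat.Prime.coprime_iff_not_dvd Nat.prime_two).mpr h2)
      ((Nat.Prime.coprime_iff_not_dvd Nat.prime_five).mpr h5)
  by_cases h2 : 2 ∣ L
  · obtain ⟨L', rfl⟩ := h2
    rw [← mul_assoc, mul_comm A] at h
    exact (hcop L' (by omega) (by omega)).dvd_of_dvd_mul_right h
  · exact ((hcop L h2 h5).dvd_of_dvd_mul_right h).mul_left 2

theorem exists_fib_dvd {n ℓ : ℕ} (hn : n % 300 = 299) (hℓ : 9 ≤ ℓ) (h : 10 ^ ℓ ∣ lucas n + 1) :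
    ∃ κ, Even κ ∧ n + 1 = 16 * κ ∧ 10 ^ (ℓ - 3) ∣ Nat.fib κ := by
  obtain ⟨c, rfl⟩ : ∃ c, n = 2 * c + 1 := ⟨n / 2, by omega⟩
  have hc : Odd c := Nat.odd_iff.mpr (by omega)
  rw [lucas_two_mul_add_one_add_one hc] at h
  have hcop := Nat.fib_coprime_fib_succ c
  have h2 : 2 ∣ Nat.fib (c + 1) := Nat.fib_dvd 3 (c + 1) (by omega)
  have h5 : 5 ∣ Nat.fib (c + 1) := Nat.fib_dvd 5 (c + 1) (by omega)
  have hcop10 : Nat.Coprime (10 ^ ℓ) (Nat.fib c) := by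
    refine Nat.Coprime.pow_left ℓ ?_
    rw [show 10 = 2 * 5 from rfl]
    exact Nat.Coprime.mul_left (hcop.symm.coprime_dvd_left h2) (hcop.symm.coprime_dvd_left h5)
  have h10 := hcop10.dvd_of_dvd_mul_right h
  have h64 : 64 ∣ Nat.fib (c + 1) := by
    have : 2 ^ 6 ∣ 5 * Nat.fib (c + 1) :=
      (pow_dvd_pow_of_dvd (by norm_num : 2 ∣ 10) 6).trans ((pow_dvd_pow 10 (by omega)).trans h10)
    exact Nat.Coprime.dvd_of_dvd_mul_left (by norm_num) this
  obtain ⟨k, hk⟩ := dvd_of_sixtyFour_dvd_fib h64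
  refine ⟨6 * k, ⟨3 * k, by ring⟩, by omega, ?_⟩
  rw [hk, show 48 * k = 2 * (2 * (2 * (6 * k))) by ring] at h10
  rw [fib_two_mul_eq_fib_mul_lucas, fib_two_mul_eq_fib_mul_lucas, fib_two_mul_eq_fib_mul_lucas,
    ← mul_assoc, ← mul_assoc, ← mul_assoc] at h10
  have he (x : ℕ) (hx : Even x) {k A : ℕ} (h : 10 ^ k ∣ A * lucas x) : 10 ^ k ∣ 2 * A :=
    ten_pow_dvd_two_mul h (not_dvd_lucas_of_even hx).1 (not_dvd_lucas_of_even hx).2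
  have h3 := he _ (even_two_mul _) h10
  rw [← mul_assoc] at h3
  have h4 := he _ (even_two_mul _) h3
  rw [← mul_assoc, ← mul_assoc] at h4
  have h5 := he _ ⟨3 * k, by ring⟩ h4
  have h6 : 10 ^ 3 * 10 ^ (ℓ - 3) ∣ 10 ^ 3 * Nat.fib (6 * k) := by
    rw [← pow_add, show 3 + (ℓ - 3) = ℓ by omega]
    exact h5.trans ⟨25, by ring⟩
  exact Nat.dvd_of_mul_dvd_mul_left (by norm_num) h6

section NormForm

variable {R S : Type*} [CommRing R] [CommRing S]

/-- The pair `(u, v)` with `h ^ i = u + v * h` whenever `h ^ 2 = b * h + 81`. -/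
def quadPow (b : R) : ℕ → R × R
  | 0 => (1, 0)
  | i + 1 => (81 * (quadPow b i).2, (quadPow b i).1 + b * (quadPow b i).2)

theorem map_quadPow (f : R →+* S) (b : R) (i : ℕ) :
    f (quadPow b i).1 = (quadPow (f b) i).1 ∧ f (quadPow b i).2 = (quadPow (f b) i).2 := by
  induction i with
  | zero => simp [quadPow]
  | succ i ih => simp [quadPow, ih, map_ofNat f 81]

theorem pow_eq_quadPow {b h : R} (hh : h ^ 2 = b * h + 81) (i : ℕ) :
    h ^ i = (quadPow b i).1 + (quadPow b i).2 * h := by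
  induction i with
  | zero => simp [quadPow]
  | succ i ih =>
    rw [pow_succ, ih, quadPow]
    linear_combination (quadPow b i).2 * hh

/-- The difference of the two Padé polynomials at `α * h / 9`, made homogeneous, where the powers of
`h` are replaced by a sequence `f`. -/
def padeForm (j : ℕ) (α z : R) (f : ℕ → R) : R :=
  ∑ i ∈ range (j + 1), (padeCoeff j i - z * padeCoeff j (j - i)) * α ^ i * 9 ^ (j - i) * f i

theorem padeForm_pow_eq (j : ℕ) (α z : R) {b h : R} (hh : h ^ 2 = b * h + 81) :
    padeForm j α z (fun i => h ^ i) = padeForm j α z (fun i => (quadPow b i).1) +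
      padeForm j α z (fun i => (quadPow b i).2) * h := by
  simp only [padeForm, sum_mul, ← sum_add_distrib, pow_eq_quadPow hh]
  refine sum_congr rfl fun i _ => ?_
  ring

/-- The norm of `padeForm` from `R[h]` to `R`, where `h ^ 2 = b * h + 81`. -/
def normForm (j : ℕ) (α z b : R) : R :=
  padeForm j α z (fun i => (quadPow b i).1) ^ 2 +
    b * padeForm j α z (fun i => (quadPow b i).1) * padeForm j α z (fun i => (quadPow b i).2) -
    81 * padeForm j α z (fun i => (quadPow b i).2) ^ 2

theorem normForm_eq_mul (j : ℕ) (α z : R) {b h h' : R} (hadd : h + h' = b) (hmul : h * h' = -81) :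
    normForm j α z b = padeForm j α z (fun i => h ^ i) * padeForm j α z (fun i => h' ^ i) := by
  have hh : h ^ 2 = b * h + 81 := by linear_combination h * hadd - hmul
  have hh' : h' ^ 2 = b * h' + 81 := by linear_combination h' * hadd - hmul
  rw [padeForm_pow_eq j α z hh, padeForm_pow_eq j α z hh', normForm]
  generalize padeForm j α z _ = p
  generalize padeForm j α z _ = q
  linear_combination (-p * q) * hadd - q ^ 2 * hmul

theorem map_padeForm (f : R →+* S) (j : ℕ) (α z : R) (g : ℕ → R) :
    f (padeForm j α z g) = padeForm j (f α) (f z) (fun i => f (g i)) := by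
  simp [padeForm, map_ofNat f 9]

theorem map_normForm (f : R →+* S) (j : ℕ) (α z b : R) :
    f (normForm j α z b) = normForm j (f α) (f z) (f b) := by
  simp only [normForm, map_sub, map_add, map_mul, map_pow, map_padeForm, map_quadPow, map_ofNat]

theorem dvd_normForm_sub (j : ℕ) (α z : R) {b b' M : R} (h : M ∣ b - b') :
    M ∣ normForm j α z b - normForm j α z b' := by
  rw [← Ideal.mem_span_singleton, ← Ideal.Quotient.eq] at h ⊢
  rw [map_normForm, map_normForm, h]

theorem pow_add_pow_eq_lucas {α β : R} (hadd : α + β = 1) (hmul : α * β = -1) (n : ℕ) :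
    α ^ n + β ^ n = lucas n := by
  have hα : α ^ 2 = α + 1 := by linear_combination α * hadd - hmul
  have hβ : β ^ 2 = β + 1 := by linear_combination β * hadd - hmul
  induction n using Nat.twoStepInduction with
  | zero => norm_num [lucas]
  | one => simpa [lucas] using hadd
  | more n h0 h1 =>
    rw [lucas_add_two]
    push_cast
    rw [← h0, ← h1]
    linear_combination α ^ n * hα + β ^ n * hβ

theorem pow_succ_eq_fib {α : R} (hα : α ^ 2 = α + 1) (n : ℕ) :
    α ^ (n + 1) = Nat.fib n + Nat.fib (n + 1) * α := by
  induction n with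
  | zero => simp
  | succ n ih =>
    rw [pow_succ, ih, Nat.fib_add_two]
    push_cast
    linear_combination (Nat.fib (n + 1) : R) * hα

theorem fib_dvd_one_sub_pow {α : R} (hα : α ^ 2 = α + 1) {κ : ℕ} (hκ : Even κ) :
    (Nat.fib κ : R) ∣ 1 - α ^ (2 * κ) := by
  rcases κ with - | c
  · simp
  have hc : Odd c := by
    rw [← Nat.not_even_iff_odd]
    exact fun h => by simp [Nat.even_add_one, h] at hκ
  have h1 := congrArg (Int.cast : ℤ → R) (fib_cassini c)
  rw [hc.neg_one_pow] at h1
  rw [show 2 * (c + 1) = 2 * c + 1 + 1 by ring, pow_succ_eq_fib hα, Nat.fib_two_mul_add_one,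
    show 2 * c + 1 + 1 = 2 * (c + 1) by ring, fib_two_mul_eq_fib_mul_lucas]
  push_cast at h1 ⊢
  exact ⟨-(2 * (Nat.fib (c + 1) : R) - Nat.fib c) - lucas (c + 1) * α, by linear_combination h1⟩

theorem dvd_normForm {α β z b M : R} (hadd : α + β = 1) (hmul : α * β = -1) {n j : ℕ}
    (hn : Odd n) (hz : z ^ 8 = α ^ (n + 1)) (hM : M ∣ (1 - z) ^ (2 * j + 1))
    (hb : M ∣ b - 9 * lucas n) : M ∣ normForm j α z b := by
  rw [dvd_iff_dvd_of_dvd_sub (dvd_normForm_sub j α z hb)]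
  have hadd' : 9 * α ^ n + 9 * β ^ n = 9 * lucas n := by
    rw [← mul_add, pow_add_pow_eq_lucas hadd hmul]
  have hmul' : 9 * α ^ n * (9 * β ^ n) = -81 := by
    have := congrArg (· ^ n) hmul
    simp only [mul_pow, hn.neg_one_pow] at this
    linear_combination 81 * this
  rw [normForm_eq_mul j α z hadd' hmul']
  refine Dvd.dvd.mul_right ?_ _
  have h1 : padeForm j α z (fun i => (9 * α ^ n) ^ i) =
      9 ^ j * (∑ i ∈ range (j + 1), (padeCoeff j i : R) * z ^ (8 * i) -
        ∑ i ∈ range (j + 1), (padeCoeff j (j - i) : R) * z ^ (8 * i + 1)) := by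
    rw [padeForm, ← sum_sub_distrib, mul_sum]
    refine sum_congr rfl fun i hi => ?_
    have h2 : (9 : R) ^ j = 9 ^ (j - i) * 9 ^ i := by
      rw [← pow_add, Nat.sub_add_cancel (by simpa [Nat.lt_succ_iff] using hi)]
    have h3 : z ^ (8 * i) = α ^ i * (α ^ n) ^ i := by
      rw [pow_mul, hz, ← mul_pow, ← pow_succ']
    rw [h2, pow_succ, h3, mul_pow]
    ring
  rw [h1]
  exact (hM.trans (one_sub_pow_dvd_pade j z)).mul_left _

end NormForm

section RealBounds

theorem padeForm_neg {j : ℕ} {α z h : ℝ} (hα : 0 < α) (hh : 0 < h) (hz : 2 * 64 ^ j < z) :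
    padeForm j α z (fun i => h ^ i) < 0 := by
  refine sum_neg (fun i hi => ?_) ⟨0, by simp⟩
  have h1 : (padeCoeff j i : ℝ) ≤ 2 * 64 ^ j := by
    exact_mod_cast (single_le_sum (fun _ _ => Nat.zero_le _) hi).trans (sum_padeCoeff_le j)
  have h2 : (1 : ℝ) ≤ padeCoeff j (j - i) := by exact_mod_cast padeCoeff_pos j (j - i)
  have h3 : (0 : ℝ) < 2 * 64 ^ j := by positivity
  have h4 : (padeCoeff j i - z * padeCoeff j (j - i) : ℝ) < 0 := by nlinarith
  have h5 : 0 < α ^ i * 9 ^ (j - i) * h ^ i := by positivity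
  have h6 := mul_neg_of_neg_of_pos h4 h5
  simpa only [mul_assoc] using h6

theorem abs_padeForm_le (j : ℕ) {α z h Y : ℝ} (hα : |α| ≤ 2) (hh : |h| ≤ Y) (hY : 9 ≤ Y) :
    |padeForm j α z (fun i => h ^ i)| ≤ 2 * 64 ^ j * (1 + |z|) * (2 * Y) ^ j := by
  have hterm : ∀ i ∈ range (j + 1),
      |((padeCoeff j i : ℝ) - z * padeCoeff j (j - i)) * α ^ i * 9 ^ (j - i) * h ^ i| ≤
        (padeCoeff j i + |z| * padeCoeff j (j - i)) * (2 * Y) ^ j := by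
    intro i hi
    have hij : j - i + i = j := Nat.sub_add_cancel (by simpa [Nat.lt_succ_iff] using hi)
    rw [abs_mul, abs_mul, abs_mul, mul_assoc, mul_assoc]
    gcongr
    · refine (abs_sub _ _).trans ?_
      rw [abs_mul, Nat.abs_cast, Nat.abs_cast]
    · rw [abs_pow, abs_pow, abs_pow, mul_pow, abs_of_pos (by norm_num : (0 : ℝ) < 9)]
      calc |α| ^ i * (9 ^ (j - i) * |h| ^ i) ≤ 2 ^ i * (Y ^ (j - i) * Y ^ i) := by gcongr
        _ = 2 ^ i * Y ^ j := by rw [← pow_add, hij]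
        _ ≤ 2 ^ j * Y ^ j := by
          gcongr
          · norm_num
          · omega
  have hsum : (∑ i ∈ range (j + 1), (padeCoeff j i : ℝ)) ≤ 2 * 64 ^ j := by
    exact_mod_cast sum_padeCoeff_le j
  have hrefl := sum_range_reflect (fun i => (padeCoeff j i : ℝ)) (j + 1)
  rw [Nat.add_sub_cancel] at hrefl
  refine (abs_sum_le_sum_abs _ _).trans ((sum_le_sum hterm).trans ?_)
  rw [← sum_mul, sum_add_distrib, ← mul_sum, hrefl]
  gcongr
  nlinarith [abs_nonneg z]

theorem exists_add_eq_mul_eq {X : ℝ} (hX : 18 ≤ X) :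
    ∃ h h' : ℝ, h + h' = X - 9 ∧ h * h' = -81 ∧ 0 < h ∧ h ≤ X ∧ |h'| ≤ 9 := by
  have hs := Real.sq_sqrt (by positivity : 0 ≤ (X - 9) ^ 2 + 324)
  have hs0 := Real.sqrt_nonneg ((X - 9) ^ 2 + 324)
  generalize √((X - 9) ^ 2 + 324) = s at hs hs0
  have h1 : s ≤ X + 9 := by nlinarith
  have h2 : X - 9 ≤ s := by nlinarith
  have h3 : s ≤ X - 9 + 18 := by nlinarith
  refine ⟨(X - 9 + s) / 2, (X - 9 - s) / 2, by ring, by linear_combination -hs / 4, by linarith,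
    by linarith, abs_le.mpr ⟨by linarith, by linarith⟩⟩

theorem abs_normForm_le (j : ℕ) {α z X : ℝ} (hα : |α| ≤ 2) (hX : 18 ≤ X) :
    |normForm j α z (X - 9)| ≤ (2 * 64 ^ j * (1 + |z|)) ^ 2 * (36 * X) ^ j := by
  obtain ⟨h, h', hadd, hmul, hpos, hle, hle'⟩ := exists_add_eq_mul_eq hX
  rw [normForm_eq_mul j α z hadd hmul, abs_mul]
  calc _ ≤ 2 * 64 ^ j * (1 + |z|) * (2 * X) ^ j * (2 * 64 ^ j * (1 + |z|) * (2 * 9) ^ j) := by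
        gcongr
        · exact abs_padeForm_le j hα (by rwa [abs_of_pos hpos]) (by linarith)
        · exact abs_padeForm_le j hα hle' le_rfl
    _ = _ := by
      rw [show 36 * X = 2 * X * (2 * 9) by ring, mul_pow (2 * X)]
      ring

end RealBounds

section GoldenIntegers

/-- The ring of integers `ℤ[ω]`, `ω ^ 2 = ω + 1`, of the golden field. -/
abbrev GoldenInt : Type := QuadraticAlgebra ℤ 1 1

theorem isSquare_of_sq_eq_mul_sq {D x y : ℤ} (hy : y ≠ 0) (h : x ^ 2 = D * y ^ 2) :
    IsSquare D := by
  obtain ⟨t, rfl⟩ : y ∣ x := by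
    rw [← Int.pow_dvd_pow_iff two_ne_zero]
    exact ⟨D, by rw [h, mul_comm]⟩
  refine ⟨t, mul_right_cancel₀ (pow_ne_zero 2 hy) ?_⟩
  rw [← h]
  ring

theorem goldenNorm_ne_zero {q : GoldenInt} (hq : q ≠ 0) : q.norm ≠ 0 := by
  intro h
  rw [QuadraticAlgebra.norm_def] at h
  have him : q.im ≠ 0 := by
    intro him
    rw [him] at h
    refine hq (QuadraticAlgebra.ext ?_ him)
    simpa using h
  obtain ⟨t, ht⟩ := isSquare_of_sq_eq_mul_sq (D := 5) (x := 2 * q.re + q.im) him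
    (by linear_combination 4 * h)
  have h1 : t < 3 := by nlinarith
  have h2 : -3 < t := by nlinarith
  interval_cases t <;> omega

theorem eq_zero_of_quadForm_eq_zero {b : ℤ} (h25 : (b ^ 2 + 324) % 25 = 5)
    (h3 : (b ^ 2 + 324) % 3 = 1) {p q : GoldenInt}
    (h : p ^ 2 + b * p * q - 81 * q ^ 2 = 0) : p = 0 ∧ q = 0 := by
  by_cases hq : q = 0
  · subst hq
    refine ⟨?_, rfl⟩
    by_contra hp
    have h1 := goldenNorm_ne_zero hp
    have h2 : p * p = 0 := by linear_combination h
    have h3 := congrArg QuadraticAlgebra.norm h2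
    rw [map_mul, QuadraticAlgebra.norm_zero] at h3
    exact h1 (mul_self_eq_zero.mp h3)
  exfalso
  have hk := goldenNorm_ne_zero hq
  obtain ⟨w, hw⟩ : ∃ w : GoldenInt, w = (2 * p + b * q) * star q := ⟨_, rfl⟩
  have hw2 : w ^ 2 = (((b ^ 2 + 324) * q.norm ^ 2 : ℤ) : GoldenInt) := by
    have h1 : ((q.norm : ℤ) : GoldenInt) = q * star q := by
      rw [← QuadraticAlgebra.algebraMap_norm_eq_mul_star]
      rfl
    push_cast
    rw [h1, hw]
    linear_combination 4 * (star q) ^ 2 * h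
  have hre := congrArg QuadraticAlgebra.re hw2
  have him := congrArg QuadraticAlgebra.im hw2
  rw [sq, QuadraticAlgebra.re_mul, QuadraticAlgebra.re_intCast, Int.cast_id] at hre
  rw [sq, QuadraticAlgebra.im_mul, QuadraticAlgebra.im_intCast] at him
  have hz : w.im * (2 * w.re + w.im) = 0 := by linear_combination him
  rcases mul_eq_zero.mp hz with hz | hz
  · obtain ⟨t, ht⟩ := isSquare_of_sq_eq_mul_sq (D := b ^ 2 + 324) (x := w.re) hk
      (by rw [hz] at hre; linear_combination hre)
    rw [ht, Int.mul_emod] at h25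
    have h1 := Int.emod_nonneg t (by norm_num : (25 : ℤ) ≠ 0)
    have h2 := Int.emod_lt_of_pos t (by norm_num : (0 : ℤ) < 25)
    generalize t % 25 = r at *
    interval_cases r <;> omega
  · obtain ⟨D', hD'⟩ : (5 : ℤ) ∣ b ^ 2 + 324 := by omega
    obtain ⟨t, rfl⟩ := isSquare_of_sq_eq_mul_sq (D := D') (x := w.re) hk (by
      rw [hD', show w.im = -2 * w.re by linear_combination hz] at hre
      refine mul_left_cancel₀ (by norm_num : (5 : ℤ) ≠ 0) ?_
      linear_combination hre)
    rw [hD', Int.mul_emod, Int.mul_emod t] at h3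
    have h1 := Int.emod_nonneg t (by norm_num : (3 : ℤ) ≠ 0)
    have h2 := Int.emod_lt_of_pos t (by norm_num : (0 : ℤ) < 3)
    generalize t % 3 = r at *
    interval_cases r <;> omega

/-- The ring homomorphism from `ℤ[ω]`, with `ω ^ 2 = ω + 1`, sending `ω` to `u`. -/
noncomputable def goldenEmb (u : ℝ) (hu : u ^ 2 = u + 1) : GoldenInt →+* ℝ :=
  (QuadraticAlgebra.lift (a := (1 : ℤ)) (b := 1)
    ⟨u, by rw [← sq, hu, one_smul, one_smul, add_comm]⟩ : GoldenInt →ₐ[ℤ] ℝ)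

theorem goldenEmb_apply {u : ℝ} (hu : u ^ 2 = u + 1) (x : GoldenInt) :
    goldenEmb u hu x = x.re + x.im * u := by
  simp [goldenEmb, QuadraticAlgebra.lift]

theorem goldenEmb_mul_goldenEmb (x : GoldenInt) :
    goldenEmb Real.goldenRatio Real.goldenRatio_sq x *
      goldenEmb Real.goldenConj Real.goldenConj_sq x = (x.norm : ℤ) := by
  rw [goldenEmb_apply, goldenEmb_apply, QuadraticAlgebra.norm_def]
  push_cast
  linear_combination (x.re * x.im : ℝ) * Real.goldenRatio_add_goldenConj +
    (x.im : ℝ) ^ 2 * Real.goldenRatio_mul_goldenConj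

end GoldenIntegers

theorem goldenRatio_pow_add_goldenConj_pow (n : ℕ) :
    Real.goldenRatio ^ n + Real.goldenConj ^ n = lucas n :=
  pow_add_pow_eq_lucas Real.goldenRatio_add_goldenConj Real.goldenRatio_mul_goldenConj n

theorem fib_le_goldenRatio_pow (n : ℕ) : (Nat.fib n : ℝ) ≤ Real.goldenRatio ^ n := by
  have h1 := Real.fib_succ_sub_goldenConj_mul_fib n
  have h2 : (Nat.fib n : ℝ) ≤ Nat.fib (n + 1) := by exact_mod_cast Nat.fib_le_fib_succ
  have h3 : (0 : ℝ) ≤ Nat.fib n := Nat.cast_nonneg _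
  nlinarith [Real.goldenConj_neg]

theorem abs_goldenConj_le_one : |Real.goldenConj| ≤ 1 :=
  abs_le.mpr ⟨Real.neg_one_lt_goldenConj.le, by linarith [Real.goldenConj_neg]⟩

theorem lucas_lt_goldenRatio_pow {n : ℕ} (hn : Odd n) :
    (lucas n : ℝ) < Real.goldenRatio ^ n ∧ Real.goldenRatio ^ n ≤ lucas n + 1 := by
  have h1 := goldenRatio_pow_add_goldenConj_pow n
  have h2 : Real.goldenConj ^ n < 0 := hn.pow_neg Real.goldenConj_neg
  have h3 : |Real.goldenConj ^ n| ≤ 1 := by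
    rw [abs_pow]
    exact pow_le_one₀ (abs_nonneg _) abs_goldenConj_le_one
  have h4 := (abs_le.mp h3).1
  constructor <;> linarith

theorem goldenEmb_normForm {u : ℝ} (hu : u ^ 2 = u + 1) (j κ : ℕ) (b : ℤ) :
    goldenEmb u hu (normForm j (⟨0, 1⟩ : GoldenInt) (⟨0, 1⟩ ^ (2 * κ)) b) =
      normForm j u (u ^ (2 * κ)) b := by
  have h1 : goldenEmb u hu ⟨0, 1⟩ = u := by simp [goldenEmb_apply]
  rw [map_normForm, map_pow, h1, map_intCast]

theorem normForm_golden_ne_zero {j κ ℓ : ℕ} (hℓ : 2 ≤ ℓ)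
    (hz : 2 * 64 ^ j < Real.goldenRatio ^ (2 * κ)) :
    normForm j (⟨0, 1⟩ : GoldenInt) (⟨0, 1⟩ ^ (2 * κ)) ((10 ^ ℓ - 9 : ℤ) : GoldenInt) ≠ 0 := by
  intro h
  obtain ⟨r, rfl⟩ := Nat.exists_eq_add_of_le hℓ
  have h25 : (((10 : ℤ) ^ (2 + r) - 9) ^ 2 + 324) % 25 = 5 := by
    rw [pow_add]
    generalize (10 : ℤ) ^ r = y
    ring_nf
    omega
  have h3 : (((10 : ℤ) ^ (2 + r) - 9) ^ 2 + 324) % 3 = 1 := by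
    have h1 : (10 : ℤ) ^ (2 + r) % 3 = 1 := by
      have : (10 : ℤ) ^ (2 + r) ≡ 1 ^ (2 + r) [ZMOD 3] := Int.ModEq.pow _ rfl
      rwa [one_pow] at this
    obtain ⟨y, hy⟩ : ∃ y, (10 : ℤ) ^ (2 + r) = 3 * y + 1 := ⟨10 ^ (2 + r) / 3, by omega⟩
    rw [hy]
    ring_nf
    omega
  have hX : (18 : ℝ) ≤ 10 ^ (2 + r) := by
    calc (18 : ℝ) ≤ 10 ^ 2 := by norm_num
      _ ≤ _ := pow_le_pow_right₀ (by norm_num) (by omega)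
  obtain ⟨hp, hq⟩ := eq_zero_of_quadForm_eq_zero h25 h3 h
  obtain ⟨x, x', hadd, hmul, hpos, -, -⟩ := exists_add_eq_mul_eq hX
  have hx : x ^ 2 = (10 ^ (2 + r) - 9) * x + 81 := by linear_combination x * hadd - hmul
  have hneg := padeForm_neg Real.goldenRatio_pos hpos hz
  rw [padeForm_pow_eq _ _ _ hx] at hneg
  have h1 : goldenEmb _ Real.goldenRatio_sq ⟨0, 1⟩ = Real.goldenRatio := by simp [goldenEmb_apply]
  have hp' := congrArg (goldenEmb _ Real.goldenRatio_sq) hp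
  have hq' := congrArg (goldenEmb _ Real.goldenRatio_sq) hq
  simp only [map_padeForm, map_quadPow, map_intCast, map_pow, h1, map_zero] at hp' hq'
  push_cast at hp' hq'
  rw [hp', hq'] at hneg
  simp at hneg

theorem ten_pow_le_of_dvd_normForm {j κ ℓ m : ℕ} (hℓ : 2 ≤ ℓ)
    (hz : 2 * 64 ^ j < Real.goldenRatio ^ (2 * κ))
    (hdvd : ((10 ^ m : ℤ) : GoldenInt) ∣
      normForm j (⟨0, 1⟩ : GoldenInt) (⟨0, 1⟩ ^ (2 * κ)) ((10 ^ ℓ - 9 : ℤ) : GoldenInt)) :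
    (10 : ℝ) ^ (2 * m) ≤
      256 * 64 ^ (4 * j) * (36 * 10 ^ ℓ) ^ (2 * j) * (Real.goldenRatio ^ (2 * κ)) ^ 2 := by
  have hne := goldenNorm_ne_zero (normForm_golden_ne_zero hℓ hz)
  have hmul := goldenEmb_mul_goldenEmb
    (normForm j (⟨0, 1⟩ : GoldenInt) (⟨0, 1⟩ ^ (2 * κ)) ((10 ^ ℓ - 9 : ℤ) : GoldenInt))
  rw [goldenEmb_normForm, goldenEmb_normForm] at hmul
  obtain ⟨y, hy⟩ := hdvd
  rw [hy, map_mul, QuadraticAlgebra.norm_intCast, Int.cast_id] at hne hmul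
  have hlow : (10 : ℝ) ^ (2 * m) ≤ |(((10 ^ m) ^ 2 * y.norm : ℤ) : ℝ)| := by
    have h1 : (1 : ℤ) ≤ |y.norm| := Int.one_le_abs (right_ne_zero_of_mul hne)
    rw [Int.cast_mul, abs_mul]
    push_cast
    rw [abs_of_pos (by positivity), ← pow_mul, mul_comm m]
    exact le_mul_of_one_le_right (by positivity) (by exact_mod_cast h1)
  rw [← hmul, abs_mul] at hlow
  have hX : (18 : ℝ) ≤ 10 ^ ℓ := by
    calc (18 : ℝ) ≤ 10 ^ 2 := by norm_num
      _ ≤ _ := pow_le_pow_right₀ (by norm_num) hℓ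
  have h2 : |Real.goldenRatio| ≤ 2 := by
    rw [abs_of_pos Real.goldenRatio_pos]
    exact Real.goldenRatio_lt_two.le
  have h3 : |Real.goldenConj| ≤ 2 := abs_goldenConj_le_one.trans (by norm_num)
  have h4 := abs_normForm_le j (z := Real.goldenRatio ^ (2 * κ)) h2 hX
  have h5 := abs_normForm_le j (z := Real.goldenConj ^ (2 * κ)) h3 hX
  have h6 : |Real.goldenConj ^ (2 * κ)| ≤ 1 := by
    rw [abs_pow]
    exact pow_le_one₀ (abs_nonneg _) abs_goldenConj_le_one
  have h7 : (1 : ℝ) ≤ Real.goldenRatio ^ (2 * κ) := one_le_pow₀ Real.one_lt_goldenRatio.le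
  push_cast at hlow
  generalize Real.goldenRatio ^ (2 * κ) = ζ at *
  rw [abs_of_pos (by linarith : 0 < ζ)] at h4
  calc _ ≤ _ := hlow
    _ ≤ (2 * 64 ^ j * (1 + ζ)) ^ 2 * (36 * 10 ^ ℓ) ^ j *
        ((2 * 64 ^ j * (1 + |Real.goldenConj ^ (2 * κ)|)) ^ 2 * (36 * 10 ^ ℓ) ^ j) := by gcongr
    _ ≤ (2 * 64 ^ j * (ζ + ζ)) ^ 2 * (36 * 10 ^ ℓ) ^ j *
        ((2 * 64 ^ j * (1 + 1)) ^ 2 * (36 * 10 ^ ℓ) ^ j) := by gcongr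
    _ = _ := by ring

theorem not_nines_eights_nines {n ℓ m : ℕ} (hn : n % 300 = 299) (hℓ : 59 ≤ ℓ)
    (h : 9 * (lucas n + 1) + 10 ^ (ℓ + m) = 9 * 10 ^ (2 * ℓ + m) + 10 ^ ℓ) : False := by
  have hodd : Odd n := Nat.odd_iff.mpr (by omega)
  have hdvd : 10 ^ ℓ ∣ lucas n + 1 := by
    refine (Nat.Coprime.pow_left ℓ (by norm_num : Nat.Coprime 10 9)).dvd_of_dvd_mul_left ?_
    rw [Nat.dvd_add_iff_left (pow_dvd_pow 10 (Nat.le_add_right ℓ m)), h]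
    exact Dvd.dvd.add ((pow_dvd_pow 10 (by omega)).mul_left 9) dvd_rfl
  obtain ⟨κ, hκ, hnκ, hfib⟩ := exists_fib_dvd hn (by omega) hdvd
  obtain ⟨k, rfl⟩ : ∃ k, ℓ = k + 3 := ⟨ℓ - 3, by omega⟩
  rw [Nat.add_sub_cancel] at hfib
  obtain ⟨ζ, hζ⟩ : ∃ ζ, ζ = Real.goldenRatio ^ (2 * κ) := ⟨_, rfl⟩
  have hζpos : 0 < ζ := hζ ▸ pow_pos Real.goldenRatio_pos _
  have hζ8 : ζ ^ 8 = Real.goldenRatio ^ n * Real.goldenRatio := by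
    rw [hζ, ← pow_mul, ← pow_succ, hnκ]
    ring_nf
  obtain ⟨hlow, hupp⟩ := lucas_lt_goldenRatio_pow hodd
  have hR : 9 * ((lucas n : ℝ) + 1) + 10 ^ (k + 3 + m) =
      9 * 10 ^ (2 * (k + 3) + m) + 10 ^ (k + 3) := by exact_mod_cast h
  have hXM : (10 : ℝ) ^ (k + 3) ≤ 10 ^ (k + 3 + m) :=
    pow_le_pow_right₀ (by norm_num) (by omega)
  have hXY : (10 : ℝ) ^ (2 * (k + 3) + m) = 10 ^ (k + 3) * 10 ^ (k + 3 + m) := by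
    rw [← pow_add]
    ring_nf
  have h10 : (10 : ℝ) ≤ 10 ^ (k + 3) := by
    simpa using pow_le_pow_right₀ (by norm_num : (1 : ℝ) ≤ 10) (by omega : 1 ≤ k + 3)
  have hζupp : ζ ^ 8 ≤ 2 * 10 ^ (2 * (k + 3) + m) := by
    have h1 := Real.goldenRatio_lt_two
    have h2 : Real.goldenRatio ^ n ≤ 10 ^ (2 * (k + 3) + m) := by linarith
    rw [hζ8]
    nlinarith [Real.goldenRatio_pos, pow_pos Real.goldenRatio_pos n]
  have hζlow : (10 : ℝ) ^ (2 * k + m + 5) < ζ ^ 8 := by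
    have h1 := Real.one_lt_goldenRatio
    have h2 : (10 : ℝ) ^ (2 * (k + 3) + m) = 10 * 10 ^ (2 * k + m + 5) := by
      rw [← pow_succ']
      ring_nf
    have h3 : (10 : ℝ) ^ (2 * k + m + 5) < Real.goldenRatio ^ n := by nlinarith
    rw [hζ8]
    nlinarith [pow_pos Real.goldenRatio_pos n]
  have hkm : 16 * k < 2 * k + m + 7 := by
    have h1 : (10 : ℝ) ^ k ≤ Real.goldenRatio ^ κ := by
      refine le_trans ?_ (fib_le_goldenRatio_pow κ)
      exact_mod_cast Nat.le_of_dvd (Nat.fib_pos.mpr (by omega)) hfib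
    have h2 : (10 : ℝ) ^ (16 * k) ≤ ζ ^ 8 := by
      calc (10 : ℝ) ^ (16 * k) = (10 ^ k) ^ 16 := by ring
        _ ≤ (Real.goldenRatio ^ κ) ^ 16 := by gcongr
        _ = _ := by rw [hζ]; ring
    have h3 : (10 : ℝ) ^ (16 * k) < 10 ^ (2 * k + m + 7) := by
      refine (h2.trans hζupp).trans_lt ?_
      rw [show 2 * k + m + 7 = 2 * (k + 3) + m + 1 by ring, pow_succ]
      have : (0 : ℝ) < 10 ^ (2 * (k + 3) + m) := by positivity
      linarith
    exact (pow_lt_pow_iff_right₀ (by norm_num)).mp h3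
  obtain ⟨j, hj1, hj2⟩ : ∃ j, m ≤ k * (2 * j + 1) ∧ 2 * k * j ≤ m + 2 * k := by
    refine ⟨m / (2 * k) + 1, ?_, ?_⟩
    · have := Nat.lt_div_mul_add (a := m) (b := 2 * k) (by omega)
      nlinarith
    · have := Nat.mul_div_le m (2 * k)
      nlinarith
  have hj3 : 112 * j ≤ m + 112 := by
    by_contra! hcon
    nlinarith
  have hz : 2 * 64 ^ j < Real.goldenRatio ^ (2 * κ) := by
    rw [← hζ]
    refine lt_of_pow_lt_pow_left₀ 8 hζpos.le (lt_of_le_of_lt ?_ hζlow)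
    calc ((2 : ℝ) * 64 ^ j) ^ 8 = 256 * (64 ^ 8) ^ j := by
          rw [mul_pow, pow_right_comm]
          norm_num
      _ ≤ 10 ^ 3 * (10 ^ 15) ^ j := by gcongr <;> norm_num
      _ = 10 ^ (3 + 15 * j) := by rw [pow_add, pow_mul]
      _ ≤ _ := pow_le_pow_right₀ (by norm_num) (by omega)
  have hmain := ten_pow_le_of_dvd_normForm (j := j) (κ := κ) (ℓ := k + 3) (m := m)
    (by omega) hz ?_
  · rw [← hζ] at hmain
    have h1 : (10 : ℝ) ^ (8 * m) < 10 ^ (10 + 44 * j + 8 * (k + 3) * j + 2 * (k + 3) + m) := by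
      calc (10 : ℝ) ^ (8 * m) = (10 ^ (2 * m)) ^ 4 := by ring
        _ ≤ (256 * 64 ^ (4 * j) * (36 * 10 ^ (k + 3)) ^ (2 * j) * ζ ^ 2) ^ 4 := by gcongr
        _ = 256 ^ 4 * (64 ^ 16 * 36 ^ 8) ^ j * 10 ^ (8 * (k + 3) * j) * ζ ^ 8 := by
          generalize (64 : ℝ) = x, (36 : ℝ) = y, (10 : ℝ) = t
          ring
        _ ≤ 256 ^ 4 * (10 ^ 44) ^ j * 10 ^ (8 * (k + 3) * j) *
            (2 * 10 ^ (2 * (k + 3) + m)) := by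
          gcongr
          norm_num
        _ = (256 ^ 4 * 2) * 10 ^ (44 * j + 8 * (k + 3) * j + 2 * (k + 3) + m) := by
          generalize (10 : ℝ) = t
          ring
        _ < 10 ^ 10 * 10 ^ (44 * j + 8 * (k + 3) * j + 2 * (k + 3) + m) := by
          gcongr
          norm_num
        _ = _ := by
          rw [← pow_add]
          ring_nf
    have h2 := (pow_lt_pow_iff_right₀ (by norm_num)).mp h1
    nlinarith
  · have hadd : (⟨0, 1⟩ : GoldenInt) + ⟨1, -1⟩ = 1 := by
      ext <;> simp [QuadraticAlgebra.re_one, QuadraticAlgebra.im_one]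
    have hmul : (⟨0, 1⟩ : GoldenInt) * ⟨1, -1⟩ = -1 := by
      ext <;> simp [QuadraticAlgebra.re_one, QuadraticAlgebra.im_one]
    have hα : (⟨0, 1⟩ : GoldenInt) ^ 2 = ⟨0, 1⟩ + 1 := by
      ext <;> simp [sq, QuadraticAlgebra.re_one, QuadraticAlgebra.im_one]
    refine dvd_normForm (n := n) hadd hmul hodd (by rw [← pow_mul, hnκ]; ring_nf) ?_ ?_
    · have h1 : ((10 ^ k : ℕ) : GoldenInt) ∣ (Nat.fib κ : GoldenInt) := Nat.cast_dvd_cast hfib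
      have h2 := pow_dvd_pow_of_dvd (h1.trans (fib_dvd_one_sub_pow hα hκ)) (2 * j + 1)
      refine Dvd.dvd.trans ?_ h2
      push_cast
      rw [← pow_mul]
      exact pow_dvd_pow _ hj1
    · have h1 : (10 ^ m : ℤ) ∣ 10 ^ (k + 3) - 9 - 9 * lucas n := by
        have h2 : 9 * ((lucas n : ℤ) + 1) + 10 ^ (k + 3 + m) =
          9 * 10 ^ (2 * (k + 3) + m) + 10 ^ (k + 3) := by exact_mod_cast h
        exact ⟨10 ^ (k + 3) - 9 * 10 ^ (2 * (k + 3)), by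
          rw [pow_add 10 (k + 3), pow_add 10 (2 * (k + 3))] at h2
          linear_combination -h2⟩
      have h2 := Int.cast_dvd_cast (α := GoldenInt) _ _ h1
      push_cast at h2 ⊢
      exact h2

end PalindromicConcat

/-- There is no Lucas number that is a palindromic concatenation of two
distinct repdigits. -/
theorem no_lucas_palindromic_concat :
    ¬ ∃ (n ℓ m : ℕ) (d1 d2 : ℤ), 1 ≤ n ∧ 1 ≤ ℓ ∧ 1 ≤ m ∧
      1 ≤ d1 ∧ d1 ≤ 9 ∧ 0 ≤ d2 ∧ d2 ≤ 9 ∧ d1 ≠ d2 ∧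
      9 * (lucas n : ℤ) =
        d1 * 10 ^ (2 * ℓ + m) - (d1 - d2) * 10 ^ (ℓ + m)
          + (d1 - d2) * 10 ^ ℓ - d1 := by
  rintro ⟨n, ℓ, m, d1, d2, -, hℓ, hm, hd1, hd1', hd2, hd2', hd, h⟩
  lift d1 to ℕ using by omega
  lift d2 to ℕ using hd2
  have h' : 9 * lucas n + d1 * 10 ^ (ℓ + m) + d2 * 10 ^ ℓ + d1 =
      d1 * 10 ^ (2 * ℓ + m) + d2 * 10 ^ (ℓ + m) + d1 * 10 ^ ℓ := by
    zify
    linear_combination h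
  obtain ⟨hn, rfl, rfl, hℓ'⟩ := mod_sieve hℓ hm (by omega) (by omega) (by omega) (by omega) h'
  refine not_nines_eights_nines hn (m := m) (by omega : 59 ≤ ℓ) ?_
  omega
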